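/- arXiv:math/0007099 — 4 statements merged into one kernel-verified Lean document; each statement's English description precedes it below -/
import Mathlib

section
/- For c̄ ∈ G let A_{c̄} denote the k-linear span in End_k(P) of the operators {X^a ∘ D^b : a, b ∈ ℕ^d, q(a) − q(b) = c̄}, and for a group homomorphism u : G → ℤ set θ_u = Σ_{i=1}^d u(q(e_i))·θ_i ∈ End_k(P). Then for all ā, b̄ ∈ G, every group homomorphism u : G → ℤ, and every f ∈ A_{ā+b̄}, one has f ∘ (θ_u + u(b̄)·id) = (θ_u − u(ā)·id) ∘ f. In particular the graded pieces satisfy A_{ā+b̄}·(θ_u + u(b̄)) = (θ_u − u(ā))·A_{ā+b̄} as subspaces of End_k(P). (This is the identification D = D′ of left and right presentations, Lemma 3.2.) -/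
open MvPolynomial

noncomputable section

/-- Multiplication by `x i` as a `k`-linear endomorphism of `P = k[x_1,…,x_d]`. -/
def Xop (k : Type) [Field k] (d : ℕ) (i : Fin d) :
    Module.End k (MvPolynomial (Fin d) k) :=
  LinearMap.mulLeft k (X i)

/-- The partial derivative `∂/∂x_i` as a `k`-linear endomorphism of `P`. -/
def Dop (k : Type) [Field k] (d : ℕ) (i : Fin d) :
    Module.End k (MvPolynomial (Fin d) k) :=
  (pderiv i).toLinearMap

/-- The Euler operator `θ_i = X_i ∘ D_i`. -/
def theta (k : Type) [Field k] (d : ℕ) (i : Fin d) :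
    Module.End k (MvPolynomial (Fin d) k) :=
  Xop k d i * Dop k d i

/-- `X^a = X_1^{a_1} ∘ ⋯ ∘ X_d^{a_d}` for `a ∈ ℕ^d`. -/
def Xpow (k : Type) [Field k] (d : ℕ) (a : Fin d → ℕ) :
    Module.End k (MvPolynomial (Fin d) k) :=
  ((List.finRange d).map fun i => Xop k d i ^ a i).prod

/-- `D^a = D_1^{a_1} ∘ ⋯ ∘ D_d^{a_d}` for `a ∈ ℕ^d`. -/
def Dpow (k : Type) [Field k] (d : ℕ) (a : Fin d → ℕ) :
    Module.End k (MvPolynomial (Fin d) k) :=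
  ((List.finRange d).map fun i => Dop k d i ^ a i).prod

/-- The map `ι : ℤ^n → ℤ^d`, `ι(h) = (h·v_1, …, h·v_d)`. -/
def iota (d n : ℕ) (v : Fin d → Fin n → ℤ) : (Fin n → ℤ) →+ (Fin d → ℤ) where
  toFun h := fun i => ∑ ℓ, h ℓ * v i ℓ
  map_zero' := by funext i; simp
  map_add' h h' := by funext i; simp [add_mul, Finset.sum_add_distrib]

/-- The class group `G = ℤ^d / ι(ℤ^n)` (in the paper, `Cl(X)`). -/
abbrev ClassGrp (d n : ℕ) (v : Fin d → Fin n → ℤ) : Type :=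
  (Fin d → ℤ) ⧸ (iota d n v).range

/-- The projection `q : ℤ^d → G`. -/
def qmap (d n : ℕ) (v : Fin d → Fin n → ℤ) : (Fin d → ℤ) →+ ClassGrp d n v :=
  QuotientAddGroup.mk' (iota d n v).range

/-- The graded piece `A_{c̄}`: the `k`-linear span in `End_k(P)` of the operators
`X^a ∘ D^b` with `q(a) − q(b) = c̄`. -/
def gradedPiece (k : Type) [Field k] (d n : ℕ) (v : Fin d → Fin n → ℤ)
    (c : ClassGrp d n v) :
    Submodule k (Module.End k (MvPolynomial (Fin d) k)) :=
  Submodule.span k {f | ∃ a b : Fin d → ℕ,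
    qmap d n v (fun i => (a i : ℤ)) - qmap d n v (fun i => (b i : ℤ)) = c ∧
    f = Xpow k d a * Dpow k d b}

/-- The Euler operator `θ_u = Σ_i u(q(e_i)) θ_i` attached to a homomorphism
`u : G → ℤ`. -/
def thetaHom (k : Type) [Field k] (d n : ℕ) (v : Fin d → Fin n → ℤ)
    (u : ClassGrp d n v →+ ℤ) : Module.End k (MvPolynomial (Fin d) k) :=
  ∑ i, u (qmap d n v (Pi.single i 1)) • theta k d i

/-- Eigenvectors of the commutator with a fixed element multiply, with eigenvalues adding. -/
theorem commutator_weight_mul {R : Type*} [Ring R] {e f g : R} {m n : ℤ}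
    (hf : e * f = f * e + m • f) (hg : e * g = g * e + n • g) :
    e * (f * g) = f * g * e + (m + n) • (f * g) := by
  rw [← mul_assoc, hf, add_mul, mul_assoc, hg, mul_add, smul_mul_assoc, mul_smul_comm,
    mul_assoc, add_smul]
  abel

theorem commutator_weight_pow {R : Type*} [Ring R] {e f : R} {m : ℤ}
    (hf : e * f = f * e + m • f) (r : ℕ) :
    e * f ^ r = f ^ r * e + ((r : ℤ) * m) • f ^ r := by
  induction r with
  | zero => simp
  | succ r ih =>
    rw [pow_succ, commutator_weight_mul ih hf]
    push_cast
    rw [add_mul, one_mul]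

theorem commutator_weight_list_prod {R ι : Type*} [Ring R] {e : R} (l : List ι)
    {f : ι → R} {m : ι → ℤ} (h : ∀ i, e * f i = f i * e + m i • f i) :
    e * (l.map f).prod = (l.map f).prod * e + (l.map m).sum • (l.map f).prod := by
  induction l with
  | nil => simp
  | cons i l ih =>
    simp only [List.map_cons, List.prod_cons, List.sum_cons]
    exact commutator_weight_mul (h i) ih

theorem pderiv_comm_apply {σ R : Type*} [CommRing R] (i j : σ) (p : MvPolynomial σ R) :
    pderiv i (pderiv j p) = pderiv j (pderiv i p) := by
  classical
  have h : ⁅pderiv (R := R) i, pderiv (R := R) j⁆ = 0 := by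
    refine MvPolynomial.derivation_ext fun l => ?_
    simp only [Derivation.commutator_apply, pderiv_X, Derivation.coe_zero, Pi.zero_apply]
    simp [Pi.single_apply, apply_ite]
  simpa [Derivation.commutator_apply, sub_eq_zero] using DFunLike.congr_fun h p

theorem theta_mul_Xop (k : Type) [Field k] (d : ℕ) (j i : Fin d) :
    theta k d j * Xop k d i =
      Xop k d i * theta k d j + (Pi.single i 1 : Fin d → ℤ) j • Xop k d i := by
  refine LinearMap.ext fun p => ?_
  by_cases h : j = i
  · subst h
    simp [theta, Xop, Dop, Derivation.leibniz]
    ring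
  · simp [theta, Xop, Dop, Derivation.leibniz, h, pderiv_X_of_ne (Ne.symm h)]
    ring

theorem theta_mul_Dop (k : Type) [Field k] (d : ℕ) (j i : Fin d) :
    theta k d j * Dop k d i =
      Dop k d i * theta k d j + (-(Pi.single i 1 : Fin d → ℤ) j) • Dop k d i := by
  refine LinearMap.ext fun p => ?_
  by_cases h : j = i
  · subst h
    simp [theta, Xop, Dop, Derivation.leibniz]
  · simp [theta, Xop, Dop, Derivation.leibniz, h, pderiv_X_of_ne h, pderiv_comm_apply i j]

theorem sum_smul_theta_commutator {k : Type} [Field k] {d : ℕ} (c : Fin d → ℤ)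
    {f : Module.End k (MvPolynomial (Fin d) k)} {m : Fin d → ℤ}
    (h : ∀ j, theta k d j * f = f * theta k d j + m j • f) :
    (∑ j, c j • theta k d j) * f = f * (∑ j, c j • theta k d j) + (∑ j, c j * m j) • f := by
  simp only [Finset.sum_mul, Finset.mul_sum, Finset.sum_smul, ← Finset.sum_add_distrib]
  refine Finset.sum_congr rfl fun j _ => ?_
  rw [smul_mul_assoc, h, smul_add, mul_smul_comm, mul_smul]

theorem map_qmap_eq_sum {d n : ℕ} {v : Fin d → Fin n → ℤ} (u : ClassGrp d n v →+ ℤ)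
    (a : Fin d → ℤ) :
    u (qmap d n v a) = ∑ i, a i * u (qmap d n v (Pi.single i 1)) := by
  conv_lhs => rw [pi_eq_sum_univ' a]
  simp only [map_sum, map_zsmul, smul_eq_mul]

theorem thetaHom_mul_Xpow (k : Type) [Field k] {d n : ℕ} {v : Fin d → Fin n → ℤ}
    (u : ClassGrp d n v →+ ℤ) (a : Fin d → ℕ) :
    thetaHom k d n v u * Xpow k d a =
      Xpow k d a * thetaHom k d n v u + u (qmap d n v fun i => (a i : ℤ)) • Xpow k d a := by
  have h (i : Fin d) := commutator_weight_pow
    (sum_smul_theta_commutator (fun j => u (qmap d n v (Pi.single j 1)))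
      (theta_mul_Xop k d · i)) (a i)
  have hw : u (qmap d n v fun i => (a i : ℤ)) = ((List.finRange d).map fun i =>
      (a i : ℤ) * ∑ j, u (qmap d n v (Pi.single j 1)) * (Pi.single i 1 : Fin d → ℤ) j).sum := by
    rw [map_qmap_eq_sum, ← List.ofFn_eq_map, List.sum_ofFn]
    simp [Pi.single_apply]
  rw [hw]
  exact commutator_weight_list_prod (List.finRange d) h

theorem thetaHom_mul_Dpow (k : Type) [Field k] {d n : ℕ} {v : Fin d → Fin n → ℤ}
    (u : ClassGrp d n v →+ ℤ) (b : Fin d → ℕ) :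
    thetaHom k d n v u * Dpow k d b =
      Dpow k d b * thetaHom k d n v u + (-u (qmap d n v fun i => (b i : ℤ))) • Dpow k d b := by
  have h (i : Fin d) := commutator_weight_pow
    (sum_smul_theta_commutator (fun j => u (qmap d n v (Pi.single j 1)))
      (theta_mul_Dop k d · i)) (b i)
  have hw : -u (qmap d n v fun i => (b i : ℤ)) = ((List.finRange d).map fun i =>
      (b i : ℤ) * ∑ j, u (qmap d n v (Pi.single j 1)) * -(Pi.single i 1 : Fin d → ℤ) j).sum := by
    rw [map_qmap_eq_sum, ← List.ofFn_eq_map, List.sum_ofFn]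
    simp [Pi.single_apply]
  rw [hw]
  exact commutator_weight_list_prod (List.finRange d) h

theorem thetaHom_mul_of_mem_gradedPiece {k : Type} [Field k] {d n : ℕ}
    {v : Fin d → Fin n → ℤ} (u : ClassGrp d n v →+ ℤ) {c : ClassGrp d n v}
    {f : Module.End k (MvPolynomial (Fin d) k)} (hf : f ∈ gradedPiece k d n v c) :
    thetaHom k d n v u * f = f * thetaHom k d n v u + u c • f := by
  induction hf using Submodule.span_induction with
  | mem f hf =>
    obtain ⟨a, b, rfl, rfl⟩ := hf
    rw [map_sub, sub_eq_add_neg]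
    exact commutator_weight_mul (thetaHom_mul_Xpow k u a) (thetaHom_mul_Dpow k u b)
  | zero => simp
  | add f g _ _ hf hg =>
    rw [mul_add, hf, hg, add_mul, smul_add]
    abel
  | smul r f _ hf =>
    rw [mul_smul_comm, hf, smul_add, smul_mul_assoc, smul_comm r]

/-- For all `ā, b̄ ∈ G`, every `u : G → ℤ` and every `f ∈ A_{ā+b̄}`, one has
`f ∘ (θ_u + u(b̄)) = (θ_u − u(ā)) ∘ f`; in particular
`A_{ā+b̄}·(θ_u + u(b̄)) = (θ_u − u(ā))·A_{ā+b̄}` as subspaces of `End_k(P)`. -/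
theorem gradedPiece_euler_exchange (k : Type) [Field k] [CharZero k] (d : ℕ) (hd : 1 ≤ d)
    (n : ℕ) (v : Fin d → Fin n → ℤ) (abar bbar : ClassGrp d n v)
    (u : ClassGrp d n v →+ ℤ) :
    (∀ f ∈ gradedPiece k d n v (abar + bbar),
        f * (thetaHom k d n v u
              + u bbar • (1 : Module.End k (MvPolynomial (Fin d) k)))
          = (thetaHom k d n v u - u abar • 1) * f) ∧
    Submodule.map (LinearMap.mulRight k (thetaHom k d n v u + u bbar • 1))
        (gradedPiece k d n v (abar + bbar))
      = Submodule.map (LinearMap.mulLeft k (thetaHom k d n v u - u abar • 1))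
        (gradedPiece k d n v (abar + bbar)) := by
  have key : ∀ f ∈ gradedPiece k d n v (abar + bbar),
      f * (thetaHom k d n v u + u bbar • (1 : Module.End k (MvPolynomial (Fin d) k)))
        = (thetaHom k d n v u - u abar • 1) * f := by
    intro f hf
    rw [sub_mul, thetaHom_mul_of_mem_gradedPiece u hf, map_add, add_smul, mul_add,
      mul_smul_comm, smul_mul_assoc, mul_one, one_mul]
    abel
  exact ⟨key, SetLike.coe_injective (Set.image_congr key)⟩
end
end

section
/- Let v_1,…,v_d ∈ ℤ^n be vectors that are all nonzero, and let b ∈ ℤ^d. For u ∈ ℤ^d set θ_u = Σ_i u_i·θ_i ∈ A and u·b = Σ_i u_i b_i ∈ ℤ. Let I ⊆ A be the left ideal (A-submodule of A) generated by the set {θ_u + (u·b)·id : u ∈ ℤ^d with Σ_i u_i·v_i = 0 in ℤ^n}. Then X^e = X_1 ∘ ⋯ ∘ X_d is not a left zero divisor on A/I; that is, for every f ∈ A, if X^e ∘ f ∈ I then f ∈ I. Consequently, the only element of the left A-module A/I annihilated by some power of X^e is zero. (Proposition: x^e ∈ 𝔟 is not a zero divisor on D_L(b̄) and H^0_𝔟(D_L(b̄))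 = 0.) -/
open MvPolynomial

noncomputable section

/-- The Weyl algebra `A`: the `k`-subalgebra of `End_k(P)` generated by
`X_1,…,X_d,D_1,…,D_d`. -/
def weylAlgebra (k : Type) [Field k] (d : ℕ) :
    Subalgebra k (Module.End k (MvPolynomial (Fin d) k)) :=
  Algebra.adjoin k (Set.range (Xop k d) ∪ Set.range (Dop k d))

/-- The falling factorial `a (a - 1) ⋯ (a + w + 1)` with `-w` factors, and `1` if `w ≥ 0`. -/
def fallingCoeff (k : Type) [Field k] (a : ℕ) (w : ℤ) : k :=
  (a.descFactorial (-w).toNat : k)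

section Scalars

variable {k : Type} [Field k]

lemma fallingCoeff_of_nonneg (a : ℕ) {w : ℤ} (hw : 0 ≤ w) : fallingCoeff k a w = 1 := by
  have : (-w).toNat = 0 := by omega
  simp [fallingCoeff, this]

lemma fallingCoeff_eq_zero (a : ℕ) {w : ℤ} (h : (a : ℤ) + w < 0) : fallingCoeff k a w = 0 := by
  have : a < (-w).toNat := by omega
  simp [fallingCoeff, Nat.descFactorial_eq_zero_iff_lt.mpr this]

lemma fallingCoeff_ne_zero [CharZero k] (a : ℕ) {w : ℤ} (h : 0 ≤ (a : ℤ) + w) :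
    fallingCoeff k a w ≠ 0 := by
  have : ¬ a < (-w).toNat := by omega
  simpa [fallingCoeff, Nat.descFactorial_eq_zero_iff_lt] using this

lemma fallingCoeff_sub_one (a : ℕ) {w : ℤ} (hw : w ≤ 0) :
    fallingCoeff k a (w - 1) = ((a : k) + w) * fallingCoeff k a w := by
  obtain ⟨m, rfl⟩ : ∃ m : ℕ, w = -(m : ℤ) := ⟨(-w).toNat, by omega⟩
  have h1 : (-(-(m : ℤ) - 1)).toNat = m + 1 := by omega
  simp only [fallingCoeff, h1, neg_neg, Int.toNat_natCast, Nat.descFactorial_succ]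
  rcases le_or_gt m a with h | h
  · push_cast [Nat.cast_sub h]
    ring
  · simp [Nat.descFactorial_eq_zero_iff_lt.mpr h]

lemma toNat_mul_fallingCoeff (a : ℕ) (w : ℤ) :
    ((((a : ℤ) + w).toNat : ℕ) : k) * fallingCoeff k a w = ((a : k) + w) * fallingCoeff k a w := by
  rcases lt_or_ge ((a : ℤ) + w) 0 with h | h
  · simp [fallingCoeff_eq_zero a h]
  · congr 1
    have : ((((a : ℤ) + w).toNat : ℤ) : k) = (((a : ℤ) + w : ℤ) : k) := by
      rw [Int.toNat_of_nonneg h]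
    rw [← Int.cast_natCast, this]
    push_cast
    rfl

end Scalars

section Homogeneous

variable {k : Type} [Field k] {d : ℕ}

/-- The exponent `a + w`, with negative entries replaced by zero. -/
def shiftExp (a : Fin d →₀ ℕ) (w : Fin d → ℤ) : Fin d →₀ ℕ :=
  Finsupp.equivFunOnFinite.symm fun i => ((a i : ℤ) + w i).toNat

@[simp] lemma shiftExp_apply (a : Fin d →₀ ℕ) (w : Fin d → ℤ) (i : Fin d) :
    shiftExp a w i = ((a i : ℤ) + w i).toNat := rfl

@[simp] lemma shiftExp_zero (a : Fin d →₀ ℕ) : shiftExp a 0 = a := by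
  ext i; simp

variable (k) in
/-- The product of the falling factorials of the entries of `a`. -/
def fallingProd (a : Fin d →₀ ℕ) (w : Fin d → ℤ) : k :=
  ∏ i, fallingCoeff k (a i) (w i)

@[simp] lemma fallingProd_zero (a : Fin d →₀ ℕ) : fallingProd k a 0 = 1 := by
  simp [fallingProd, fallingCoeff_of_nonneg]

lemma fallingProd_eq_zero (a : Fin d →₀ ℕ) (w : Fin d → ℤ) (i : Fin d)
    (h : (a i : ℤ) + w i < 0) : fallingProd k a w = 0 :=
  Finset.prod_eq_zero (Finset.mem_univ i) (fallingCoeff_eq_zero _ h)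

lemma fallingProd_ne_zero [CharZero k] (a : Fin d →₀ ℕ) (w : Fin d → ℤ)
    (h : ∀ i, 0 ≤ (a i : ℤ) + w i) : fallingProd k a w ≠ 0 :=
  Finset.prod_ne_zero_iff.mpr fun i _ => fallingCoeff_ne_zero _ (h i)

/-- Two falling products for weights that agree away from `i` are proportional as soon as
their `i`-th factors are. -/
lemma mul_fallingProd_congr (a : Fin d →₀ ℕ) (w w' : Fin d → ℤ) (i : Fin d)
    (h : ∀ j, j ≠ i → w j = w' j) (c c' : k)
    (hc : c * fallingCoeff k (a i) (w i) = c' * fallingCoeff k (a i) (w' i)) :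
    c * fallingProd k a w = c' * fallingProd k a w' := by
  unfold fallingProd
  rw [← Finset.mul_prod_erase _ _ (Finset.mem_univ i),
    ← Finset.mul_prod_erase _ (fun j => fallingCoeff k (a j) (w' j)) (Finset.mem_univ i),
    ← mul_assoc, ← mul_assoc, hc]
  congr 1
  refine Finset.prod_congr rfl fun j hj => ?_
  rw [h j (Finset.ne_of_mem_erase hj)]

variable (k) in
/-- The operator of weight `w` with coefficient `g`, namely `X^{w⁺} D^{w⁻} g(θ)`, described by
its effect on monomials. -/
def weightOp (w : Fin d → ℤ) :
    MvPolynomial (Fin d) k →ₗ[k] Module.End k (MvPolynomial (Fin d) k) where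
  toFun g := (basisMonomials (Fin d) k).constr k fun a =>
    monomial (shiftExp a w) (eval (fun i => (a i : k)) g * fallingProd k a w)
  map_add' g h := by
    refine (basisMonomials (Fin d) k).ext fun a => ?_
    simp only [LinearMap.add_apply, Module.Basis.constr_basis, map_add, add_mul]
  map_smul' c g := by
    refine (basisMonomials (Fin d) k).ext fun a => ?_
    simp only [LinearMap.smul_apply, Module.Basis.constr_basis, smul_eval, mul_assoc,
      RingHom.id_apply, smul_monomial, smul_eq_mul]

lemma weightOp_monomial (w : Fin d → ℤ) (g : MvPolynomial (Fin d) k) (a : Fin d →₀ ℕ) :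
    weightOp k w g (monomial a 1) =
      monomial (shiftExp a w) (eval (fun i => (a i : k)) g * fallingProd k a w) := by
  have := (basisMonomials (Fin d) k).constr_basis k (fun a =>
    monomial (shiftExp a w) (eval (fun i => (a i : k)) g * fallingProd k a w)) a
  rwa [coe_basisMonomials] at this

lemma end_ext {S T : Module.End k (MvPolynomial (Fin d) k)}
    (h : ∀ a, S (monomial a 1) = T (monomial a 1)) : S = T :=
  (basisMonomials (Fin d) k).ext fun a => by simpa only [coe_basisMonomials] using h a

lemma weightOp_apply_monomial_coeff (w : Fin d → ℤ) (g : MvPolynomial (Fin d) k)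
    (a : Fin d →₀ ℕ) (c : k) : weightOp k w g (monomial a c) =
      c • weightOp k w g (monomial a 1) := by
  rw [← map_smul, smul_monomial, smul_eq_mul, mul_one]

lemma weightOp_mul (w : Fin d → ℤ) (g h : MvPolynomial (Fin d) k) :
    weightOp k w (g * h) = weightOp k w g * weightOp k 0 h := by
  refine end_ext fun a => ?_
  rw [Module.End.mul_apply, weightOp_monomial, weightOp_monomial, shiftExp_zero,
    weightOp_apply_monomial_coeff, weightOp_monomial, smul_monomial, smul_eq_mul,
    RingHom.map_mul, fallingProd_zero]
  congr 1
  ring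

lemma weightOp_zero_one : weightOp k (0 : Fin d → ℤ) 1 = 1 := by
  refine end_ext fun a => ?_
  simp [weightOp_monomial]

variable (k) in
/-- The coefficient produced by moving `X_i` past the weight `w`. -/
def raiseCoeff (i : Fin d) (w : Fin d → ℤ) : MvPolynomial (Fin d) k :=
  if 0 ≤ w i then 1 else X i + C ((w i : k) + 1)

variable (k) in
/-- The coefficient produced by moving `D_i` past the weight `w`. -/
def lowerCoeff (i : Fin d) (w : Fin d → ℤ) : MvPolynomial (Fin d) k :=
  if w i ≤ 0 then 1 else X i + C (w i : k)

lemma Xop_mul_weightOp (i : Fin d) (w : Fin d → ℤ) (g : MvPolynomial (Fin d) k) :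
    Xop k d i * weightOp k w g = weightOp k (w + Pi.single i 1) (raiseCoeff k i w * g) := by
  refine end_ext fun a => ?_
  have key : fallingProd k a w =
      eval (fun i => (a i : k)) (raiseCoeff k i w) * fallingProd k a (w + Pi.single i 1) := by
    rw [← one_mul (fallingProd k a w)]
    refine mul_fallingProd_congr a _ _ i (fun j hj => by simp [hj]) _ _ ?_
    rw [one_mul, Pi.add_apply, Pi.single_eq_same]
    unfold raiseCoeff
    split_ifs with h
    · rw [map_one, one_mul, fallingCoeff_of_nonneg _ h, fallingCoeff_of_nonneg _ (by omega)]
    · have := fallingCoeff_sub_one (k := k) (a i) (w := w i + 1) (by omega)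
      rw [add_sub_cancel_right] at this
      rw [this]
      simp
  rw [Module.End.mul_apply, weightOp_monomial, weightOp_monomial, Xop, LinearMap.mulLeft_apply,
    X, monomial_mul, one_mul, RingHom.map_mul]
  by_cases h : (a i : ℤ) + w i < 0
  · have h0 := fallingProd_eq_zero (k := k) a w i h
    rw [mul_right_comm, ← key, h0]
    simp
  · rw [mul_right_comm, ← key, mul_comm]
    congr 2
    ext j
    by_cases hj : j = i
    · subst hj
      simp
      omega
    · simp [hj]

lemma Dop_mul_weightOp (i : Fin d) (w : Fin d → ℤ) (g : MvPolynomial (Fin d) k) :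
    Dop k d i * weightOp k w g = weightOp k (w - Pi.single i 1) (lowerCoeff k i w * g) := by
  refine end_ext fun a => ?_
  have key : (shiftExp a w i : k) * fallingProd k a w =
      eval (fun i => (a i : k)) (lowerCoeff k i w) * fallingProd k a (w - Pi.single i 1) := by
    refine mul_fallingProd_congr a _ _ i (fun j hj => by simp [hj]) _ _ ?_
    rw [Pi.sub_apply, Pi.single_eq_same, shiftExp_apply, toNat_mul_fallingCoeff]
    unfold lowerCoeff
    split_ifs with h
    · rw [map_one, one_mul, fallingCoeff_sub_one _ h]
    · rw [fallingCoeff_of_nonneg (k := k) _ (w := w i) (by omega),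
        fallingCoeff_of_nonneg (k := k) _ (w := w i - 1) (by omega)]
      simp
  rw [Module.End.mul_apply, weightOp_monomial, weightOp_monomial, Dop]
  simp only [Derivation.coeFn_coe, pderiv_monomial, RingHom.map_mul]
  rw [mul_right_comm (eval _ (lowerCoeff k i w)), ← key]
  have hs : shiftExp a w - Finsupp.single i 1 = shiftExp a (w - Pi.single i 1) := by
    ext j
    by_cases hj : j = i
    · subst hj
      simp
      omega
    · simp [hj]
  rw [hs]
  congr 1
  ring

lemma weightOp_zero_X (i : Fin d) : weightOp k (0 : Fin d → ℤ) (X i) = theta k d i := by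
  rw [theta, ← mul_one (Dop k d i), ← weightOp_zero_one, Dop_mul_weightOp, Xop_mul_weightOp]
  simp [lowerCoeff, raiseCoeff]

end Homogeneous

section WeylAlgebra

variable {k : Type} [Field k] {d : ℕ}

lemma Xop_mem_weylAlgebra (i : Fin d) : Xop k d i ∈ weylAlgebra k d :=
  Algebra.subset_adjoin (Or.inl ⟨i, rfl⟩)

lemma Dop_mem_weylAlgebra (i : Fin d) : Dop k d i ∈ weylAlgebra k d :=
  Algebra.subset_adjoin (Or.inr ⟨i, rfl⟩)

lemma weightOp_zero_mem (g : MvPolynomial (Fin d) k) :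
    weightOp k (0 : Fin d → ℤ) g ∈ weylAlgebra k d := by
  induction g using MvPolynomial.induction_on with
  | C c =>
    rw [← mul_one (C c), C_mul', map_smul, weightOp_zero_one]
    exact Subalgebra.smul_mem _ (one_mem _) c
  | add p q hp hq => rw [map_add]; exact add_mem hp hq
  | mul_X p i hp =>
    rw [weightOp_mul, weightOp_zero_X]
    exact mul_mem hp (mul_mem (Xop_mem_weylAlgebra i) (Dop_mem_weylAlgebra i))

lemma sum_natAbs_lt {w w' : Fin d → ℤ} (i : Fin d) (h : ∀ j, j ≠ i → w' j = w j)
    (hi : (w' i).natAbs < (w i).natAbs) : ∑ j, (w' j).natAbs < ∑ j, (w j).natAbs := by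
  refine Finset.sum_lt_sum (fun j _ => ?_) ⟨i, Finset.mem_univ i, hi⟩
  by_cases hj : j = i
  · exact hj ▸ hi.le
  · rw [h j hj]

lemma weightOp_one_mem (w : Fin d → ℤ) : weightOp k w 1 ∈ weylAlgebra k d := by
  induction hN : ∑ i, (w i).natAbs using Nat.strong_induction_on generalizing w with
  | _ N ih =>
    subst hN
    by_cases hw : w = 0
    · rw [hw, weightOp_zero_one]
      exact one_mem _
    obtain ⟨i, hi⟩ := Function.ne_iff.mp hw
    simp only [Pi.zero_apply] at hi
    rcases lt_or_gt_of_ne hi with h | h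
    · have hlt := sum_natAbs_lt (w := w) (w' := w + Pi.single i 1) i
        (fun j hj => by simp [hj]) (by simp; omega)
      have := mul_mem (Dop_mem_weylAlgebra i) (ih _ hlt _ rfl)
      rwa [Dop_mul_weightOp, add_sub_cancel_right, lowerCoeff, if_pos (by simp; omega),
        one_mul] at this
    · have hlt := sum_natAbs_lt (w := w) (w' := w - Pi.single i 1) i
        (fun j hj => by simp [hj]) (by simp; omega)
      have := mul_mem (Xop_mem_weylAlgebra i) (ih _ hlt _ rfl)
      rwa [Xop_mul_weightOp, sub_add_cancel, raiseCoeff, if_pos (by simp; omega),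
        one_mul] at this

lemma weightOp_mem (w : Fin d → ℤ) (g : MvPolynomial (Fin d) k) :
    weightOp k w g ∈ weylAlgebra k d := by
  rw [← one_mul g, weightOp_mul]
  exact mul_mem (weightOp_one_mem w) (weightOp_zero_mem g)

variable (k d) in
/-- The operator `∑_w X^{w⁺} D^{w⁻} g_w(θ)` attached to a finitely supported family `g`. -/
def normalForm :
    ((Fin d → ℤ) →₀ MvPolynomial (Fin d) k) →ₗ[k] Module.End k (MvPolynomial (Fin d) k) :=
  Finsupp.lsum k (weightOp k)

lemma normalForm_single (w : Fin d → ℤ) (g : MvPolynomial (Fin d) k) :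
    normalForm k d (Finsupp.single w g) = weightOp k w g := by
  simp [normalForm]

lemma normalForm_apply (g : (Fin d → ℤ) →₀ MvPolynomial (Fin d) k) :
    normalForm k d g = ∑ w ∈ g.support, weightOp k w (g w) := rfl

lemma normalForm_injective [CharZero k] : Function.Injective (normalForm k d) := by
  rw [injective_iff_map_eq_zero]
  intro g hg
  ext1 w
  refine funext_set (fun i => Set.range fun m : ℕ => ((m + (-(w i)).toNat : ℕ) : k))
    (fun i => Set.infinite_range_of_injective fun m m' h => by
      simpa using (Nat.cast_injective (R := k) h)) fun x hx => ?_
  rw [Finsupp.coe_zero, Pi.zero_apply, map_zero]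
  choose m hm using fun i => hx i (Set.mem_univ i)
  let a : Fin d →₀ ℕ := Finsupp.equivFunOnFinite.symm fun i => m i + (-(w i)).toNat
  have ha : ∀ i, a i = m i + (-(w i)).toNat := fun i => rfl
  have hxa : x = fun i => (a i : k) := funext fun i => (hm i).symm
  have haw : ∀ i, 0 ≤ (a i : ℤ) + w i := fun i => by rw [ha]; omega
  have hc := congrArg (coeff (shiftExp a w)) (LinearMap.congr_fun hg (monomial a 1))
  rw [normalForm_apply, LinearMap.sum_apply, coeff_sum, LinearMap.zero_apply, coeff_zero,
    Finset.sum_eq_single w, weightOp_monomial, coeff_monomial, if_pos rfl] at hc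
  · rw [hxa]
    exact (mul_eq_zero.mp hc).resolve_right (fallingProd_ne_zero a w haw)
  · intro w' _ hw'
    rw [weightOp_monomial, coeff_monomial]
    split_ifs with h
    · obtain ⟨i, hi⟩ := Function.ne_iff.mp hw'
      have hs := DFunLike.congr_fun h i
      simp only [shiftExp_apply] at hs
      have := haw i
      rw [fallingProd_eq_zero a w' i (by omega), mul_zero]
    · rfl
  · intro h
    rw [Finsupp.notMem_support_iff.mp h]
    simp

/-- A subspace of operators stable under left multiplication by every `X_i` and `D_i` is
stable under left multiplication by the Weyl algebra. -/
lemma mul_mem_of_stable (R : Submodule k (Module.End k (MvPolynomial (Fin d) k)))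
    (hX : ∀ i, ∀ r ∈ R, Xop k d i * r ∈ R) (hD : ∀ i, ∀ r ∈ R, Dop k d i * r ∈ R)
    {f : Module.End k (MvPolynomial (Fin d) k)} (hf : f ∈ weylAlgebra k d) :
    ∀ r ∈ R, f * r ∈ R := by
  refine Algebra.adjoin_induction (p := fun f _ => ∀ r ∈ R, f * r ∈ R) ?_ ?_ ?_ ?_ hf
  · rintro _ (⟨i, rfl⟩ | ⟨i, rfl⟩)
    exacts [hX i, hD i]
  · intro c r hr
    rw [← Algebra.smul_def]
    exact R.smul_mem c hr
  · intro f g _ _ hf hg r hr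
    rw [add_mul]
    exact R.add_mem (hf r hr) (hg r hr)
  · intro f g _ _ hf hg r hr
    rw [mul_assoc]
    exact hf _ (hg r hr)

/-- The operators all of whose normal form coefficients can be chosen in `J`. -/
def coeffIn (J : Ideal (MvPolynomial (Fin d) k)) :
    Submodule k (Module.End k (MvPolynomial (Fin d) k)) :=
  ⨆ w : Fin d → ℤ, (J.restrictScalars k).map (weightOp k w)

lemma weightOp_mem_coeffIn {J : Ideal (MvPolynomial (Fin d) k)} (w : Fin d → ℤ)
    {g : MvPolynomial (Fin d) k} (hg : g ∈ J) : weightOp k w g ∈ coeffIn J :=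
  Submodule.mem_iSup_of_mem w ⟨g, hg, rfl⟩

lemma coeffIn_induction {J : Ideal (MvPolynomial (Fin d) k)}
    {S : Submodule k (Module.End k (MvPolynomial (Fin d) k))}
    (h : ∀ w, ∀ g ∈ J, weightOp k w g ∈ S) : coeffIn J ≤ S := by
  refine iSup_le fun w => ?_
  rintro _ ⟨g, hg, rfl⟩
  exact h w g hg

lemma exists_normalForm_of_mem_coeffIn {J : Ideal (MvPolynomial (Fin d) k)}
    {f : Module.End k (MvPolynomial (Fin d) k)} (hf : f ∈ coeffIn J) :
    ∃ g, (∀ w, g w ∈ J) ∧ normalForm k d g = f := by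
  let N : Submodule k ((Fin d → ℤ) →₀ MvPolynomial (Fin d) k) :=
    { carrier := {g | ∀ w, g w ∈ J}
      zero_mem' := fun w => J.zero_mem
      add_mem' := fun hg hh w => J.add_mem (hg w) (hh w)
      smul_mem' := fun c g hg w => (J.restrictScalars k).smul_mem c (hg w) }
  have : coeffIn J ≤ N.map (normalForm k d) := by
    refine coeffIn_induction fun w g hg => ⟨Finsupp.single w g, fun w' => ?_, normalForm_single w g⟩
    rw [Finsupp.single_apply]
    split_ifs
    exacts [hg, J.zero_mem]
  exact this hf

lemma mul_mem_coeffIn (J : Ideal (MvPolynomial (Fin d) k))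
    {f : Module.End k (MvPolynomial (Fin d) k)} (hf : f ∈ weylAlgebra k d) :
    ∀ r ∈ coeffIn J, f * r ∈ coeffIn J := by
  refine mul_mem_of_stable _ (fun i => ?_) (fun i => ?_) hf
  · exact coeffIn_induction (S := (coeffIn J).comap (LinearMap.mulLeft k (Xop k d i)))
      fun w g hg => by
        rw [Submodule.mem_comap, LinearMap.mulLeft_apply, Xop_mul_weightOp]
        exact weightOp_mem_coeffIn _ (J.mul_mem_left _ hg)
  · exact coeffIn_induction (S := (coeffIn J).comap (LinearMap.mulLeft k (Dop k d i)))
      fun w g hg => by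
        rw [Submodule.mem_comap, LinearMap.mulLeft_apply, Dop_mul_weightOp]
        exact weightOp_mem_coeffIn _ (J.mul_mem_left _ hg)

lemma exists_normalForm {f : Module.End k (MvPolynomial (Fin d) k)} (hf : f ∈ weylAlgebra k d) :
    ∃ g, normalForm k d g = f := by
  have h1 : (1 : Module.End k (MvPolynomial (Fin d) k)) ∈
      coeffIn (⊤ : Ideal (MvPolynomial (Fin d) k)) :=
    weightOp_zero_one (k := k) (d := d) ▸ weightOp_mem_coeffIn 0 trivial
  have := mul_mem_coeffIn ⊤ hf 1 h1
  rw [mul_one] at this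
  obtain ⟨g, -, hg⟩ := exists_normalForm_of_mem_coeffIn this
  exact ⟨g, hg⟩

lemma Xop_mul_normalForm (i : Fin d) (g : (Fin d → ℤ) →₀ MvPolynomial (Fin d) k) :
    ∃ g', (∀ w, g' (w + Pi.single i 1) = raiseCoeff k i w * g w) ∧
      Xop k d i * normalForm k d g = normalForm k d g' := by
  induction g using Finsupp.induction_linear with
  | zero => exact ⟨0, by simp, by simp⟩
  | add g h hg hh =>
    obtain ⟨g', hg', hg⟩ := hg
    obtain ⟨h', hh', hh⟩ := hh
    exact ⟨g' + h', fun w => by simp [hg', hh', mul_add], by rw [map_add, mul_add, hg, hh, map_add]⟩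
  | single w p =>
    refine ⟨Finsupp.single (w + Pi.single i 1) (raiseCoeff k i w * p), fun w' => ?_, ?_⟩
    · simp only [Finsupp.single_apply, add_left_inj]
      split_ifs with h
      · rw [h]
      · rw [mul_zero]
    · rw [normalForm_single, normalForm_single, Xop_mul_weightOp]

/-- If every `X i + C c` is a non-zero-divisor modulo `J`, then `X_i` cancels on the left
modulo the operators with coefficients in `J`. -/
lemma mem_coeffIn_of_Xop_mul_mem [CharZero k] {J : Ideal (MvPolynomial (Fin d) k)} {i : Fin d}
    (hJ : ∀ (c : k) (g : MvPolynomial (Fin d) k), (X i + C c) * g ∈ J → g ∈ J)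
    {f : Module.End k (MvPolynomial (Fin d) k)} (hf : f ∈ weylAlgebra k d)
    (h : Xop k d i * f ∈ coeffIn J) : f ∈ coeffIn J := by
  obtain ⟨g, rfl⟩ := exists_normalForm hf
  obtain ⟨g', hg', hX⟩ := Xop_mul_normalForm i g
  obtain ⟨p, hp, hpX⟩ := exists_normalForm_of_mem_coeffIn h
  obtain rfl : p = g' := normalForm_injective (hpX.trans hX)
  rw [normalForm_apply]
  refine Submodule.sum_mem _ fun w _ => weightOp_mem_coeffIn w ?_
  have hw := hp (w + Pi.single i 1)
  rw [hg'] at hw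
  unfold raiseCoeff at hw
  split_ifs at hw
  · rwa [one_mul] at hw
  · exact hJ _ _ hw

end WeylAlgebra

/-- Let `J` be generated by polynomials invariant under translation along `h`.  If `h i ≠ 0`,
then `X i + C c` is a non-zero-divisor modulo `J`. -/
lemma mem_of_X_add_C_mul_mem {k σ : Type} [Field k] (S : Set (MvPolynomial σ k)) (h : σ → k)
    (hS : ∀ p ∈ S, aeval (fun j => Polynomial.C (Ideal.Quotient.mk (Ideal.span S) (X j))
      + Polynomial.C (algebraMap k _ (h j)) * Polynomial.X) p
        = Polynomial.C (Ideal.Quotient.mk (Ideal.span S) p))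
    (i : σ) (hi : h i ≠ 0) (c : k) (g : MvPolynomial σ k)
    (hg : (X i + C c) * g ∈ Ideal.span S) : g ∈ Ideal.span S := by
  set J := Ideal.span S with hJ
  let τ : MvPolynomial σ k →ₐ[k] Polynomial (MvPolynomial σ k ⧸ J) :=
    aeval fun j => Polynomial.C (Ideal.Quotient.mk J (X j))
      + Polynomial.C (algebraMap k _ (h j)) * Polynomial.X
  have hτJ : ∀ p ∈ J, τ p = 0 := by
    have : J ≤ RingHom.ker τ := Ideal.span_le.mpr fun p hp => by
      change τ p = 0
      rw [show τ p = _ from hS p hp, Ideal.Quotient.eq_zero_iff_mem.mpr (Ideal.subset_span hp),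
        map_zero]
    exact fun p hp => this hp
  have hτ0 : ∀ p, (τ p).eval 0 = Ideal.Quotient.mk J p := by
    intro p
    induction p using MvPolynomial.induction_on with
    | C c =>
      rw [show τ (C c) = _ from τ.commutes c, Polynomial.algebraMap_apply, Polynomial.eval_C]
      rfl
    | add p q hp hq => rw [map_add, Polynomial.eval_add, hp, hq, map_add]
    | mul_X p j hp =>
      rw [map_mul, Polynomial.eval_mul, hp, map_mul]
      simp [τ]
  have hL : τ (C (h i)⁻¹ * (X i + C c)) =
      Polynomial.X + Polynomial.C (Ideal.Quotient.mk J (C (h i)⁻¹ * (X i + C c))) := by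
    have hC : ∀ a : k, τ (C a) = Polynomial.C (algebraMap k _ a) := fun a => τ.commutes a
    have hq : ∀ a : k, Ideal.Quotient.mk J (C a) = algebraMap k _ a := fun a => rfl
    have hm : (Polynomial.C (algebraMap k (MvPolynomial σ k ⧸ J) (h i)⁻¹)) *
        Polynomial.C (algebraMap k _ (h i)) = 1 := by
      rw [← map_mul, ← map_mul, inv_mul_cancel₀ hi, map_one, map_one]
    rw [map_mul, map_add, hC, hC, map_mul, map_add, hq, hq, map_mul, map_add,
      show τ (X i) = _ from aeval_X _ i]
    linear_combination Polynomial.X * hm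
  have hz : τ (C (h i)⁻¹ * (X i + C c)) * τ g = 0 := by
    rw [← map_mul, mul_assoc]
    exact hτJ _ (J.mul_mem_left _ hg)
  rw [hL] at hz
  have hτg : τ g = 0 := (Polynomial.monic_X_add_C _).mul_right_eq_zero_iff.mp hz
  rw [← Ideal.Quotient.eq_zero_iff_mem, ← hτ0, hτg, Polynomial.eval_zero]

/-- Let `I` be the left ideal of `A` generated by the operators `θ_u + (u·b)·id` for
`u ∈ ℤ^d` with `Σ u_i v_i = 0` (the `v_i` being nonzero).  Then `X^e = X_1 ∘ ⋯ ∘ X_d` is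
not a left zero divisor on `A/I`, and the only element of `A/I` annihilated by a power of
`X^e` is zero. -/
theorem xe_not_zero_divisor (k : Type) [Field k] [CharZero k] (d : ℕ) (hd : 1 ≤ d)
    (n : ℕ) (v : Fin d → Fin n → ℤ) (hv : ∀ i, v i ≠ 0) (b : Fin d → ℤ) :
    let A := weylAlgebra k d
    let I : Submodule A (Module.End k (MvPolynomial (Fin d) k)) :=
      Submodule.span A {g | ∃ u : Fin d → ℤ, (∑ i, u i • v i) = 0 ∧
        g = (∑ i, u i • theta k d i)
          + (∑ i, u i * b i) • (1 : Module.End k (MvPolynomial (Fin d) k))}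
    (∀ f ∈ A, Xpow k d (fun _ => 1) * f ∈ I → f ∈ I) ∧
    (∀ f ∈ A, (∃ m : ℕ, (Xpow k d (fun _ => 1)) ^ m * f ∈ I) → f ∈ I) := by
  intro A I
  let S : Set (MvPolynomial (Fin d) k) := {p | ∃ u : Fin d → ℤ, (∑ i, u i • v i) = 0 ∧
    p = (∑ i, u i • X i) + (∑ i, u i * b i) • (1 : MvPolynomial (Fin d) k)}
  have hS : ∀ u : Fin d → ℤ, weightOp k 0 ((∑ i, u i • X i) +
      (∑ i, u i * b i) • (1 : MvPolynomial (Fin d) k)) = (∑ i, u i • theta k d i)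
        + (∑ i, u i * b i) • (1 : Module.End k (MvPolynomial (Fin d) k)) := fun u => by
    simp only [map_add, map_sum, map_zsmul, weightOp_zero_X, weightOp_zero_one]
  have hI : ∀ f, f ∈ I ↔ f ∈ coeffIn (Ideal.span S) := by
    intro f
    constructor
    · intro hf
      refine Submodule.span_induction (p := fun f _ => f ∈ coeffIn (Ideal.span S))
        ?_ (zero_mem _) (fun _ _ _ _ => add_mem)
        (fun a x _ hx => mul_mem_coeffIn _ a.2 x hx) hf
      rintro _ ⟨u, hu, rfl⟩
      rw [← hS]
      exact weightOp_mem_coeffIn 0 (Ideal.subset_span ⟨u, hu, rfl⟩)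
    · intro hf
      refine coeffIn_induction (S := I.restrictScalars k) (fun w g hg => ?_) hf
      rw [Submodule.restrictScalars_mem]
      induction hg using Submodule.span_induction generalizing w with
      | mem p hp =>
        obtain ⟨u, hu, rfl⟩ := hp
        rw [← one_mul (_ + _), weightOp_mul, hS]
        exact I.smul_mem (⟨_, weightOp_mem w 1⟩ : A) (Submodule.subset_span ⟨u, hu, rfl⟩)
      | zero => rw [map_zero]; exact I.zero_mem
      | add p q _ _ hp hq => rw [map_add]; exact I.add_mem (hp w) (hq w)
      | smul a p _ hp =>
        rw [smul_eq_mul, weightOp_mul]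
        exact I.smul_mem (⟨_, weightOp_mem w a⟩ : A) (hp 0)
  have hX : ∀ i, ∀ f ∈ A, Xop k d i * f ∈ I → f ∈ I := by
    intro i f hf h
    rw [hI] at h ⊢
    refine mem_coeffIn_of_Xop_mul_mem (fun c g hg => ?_) hf h
    obtain ⟨j, hj⟩ := Function.ne_iff.mp (hv i)
    refine mem_of_X_add_C_mul_mem S (fun l => (v l j : k)) ?_ i (by simpa using hj) c g hg
    rintro _ ⟨u, hu, rfl⟩
    have huj : ∑ l, (u l : k) * (v l j : k) = 0 := by
      have := congrFun hu j
      simp only [Finset.sum_apply, Pi.smul_apply, smul_eq_mul, Pi.zero_apply] at this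
      exact_mod_cast congrArg (Int.cast : ℤ → k) this
    have huj' : ∑ l, u l • (Polynomial.C (algebraMap k (MvPolynomial (Fin d) k ⧸ Ideal.span S)
        (v l j : k)) * Polynomial.X) = 0 := by
      have := congrArg (fun t => Polynomial.C (algebraMap k (MvPolynomial (Fin d) k ⧸ Ideal.span S)
        t) * Polynomial.X) huj
      simpa only [map_sum, map_mul, map_intCast, map_zero, zero_mul, Finset.sum_mul, mul_assoc,
        zsmul_eq_mul] using this
    simp only [map_add, map_sum, map_zsmul, map_one, aeval_X, smul_add, Finset.sum_add_distrib,
      huj', add_zero]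
  have hlist : ∀ l : List (Fin d), (l.map (Xop k d)).prod ∈ A ∧
      ∀ f ∈ A, (l.map (Xop k d)).prod * f ∈ I → f ∈ I := by
    intro l
    induction l with
    | nil => exact ⟨one_mem _, fun f _ h => by simpa using h⟩
    | cons i l ih =>
      simp only [List.map_cons, List.prod_cons]
      refine ⟨mul_mem (Xop_mem_weylAlgebra i) ih.1, fun f hf h => ih.2 f hf ?_⟩
      rw [mul_assoc] at h
      exact hX i _ (mul_mem ih.1 hf) h
  have hXe : Xpow k d (fun _ => 1) = ((List.finRange d).map (Xop k d)).prod := by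
    simp only [Xpow, pow_one]
  obtain ⟨hmem, hcancel⟩ := hlist (List.finRange d)
  rw [← hXe] at hmem hcancel
  refine ⟨hcancel, ?_⟩
  rintro f hf ⟨m, hm⟩
  induction m with
  | zero => simpa using hm
  | succ m ih =>
    rw [pow_succ', mul_assoc] at hm
    exact ih (hcancel _ (mul_mem (pow_mem hmem m) hf) hm)
end
end

section
/- Let r ≤ d and let u_1,…,u_r ∈ ℤ^d be linearly independent over ℚ. Then p_{u_1},…,p_{u_r} is a regular sequence in R, and the Krull dimension of the quotient ring R/(p_{u_1},…,p_{u_r}) equals 2d − r. (Part of Proposition 5.7: taking r = d − n and u_1,…,u_{d−n} representing a basis of Cl(X)^∨, the variety Z = V(𝔭) is a complete intersection of dimension d + n.) -/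
open MvPolynomial

noncomputable section

/-- The principal symbol `p_u = Σ_i u_i · x_i ξ_i` of the Euler operator `θ_u`, as an
element of `R = k[x_1,…,x_d,ξ_1,…,ξ_d]`. -/
def pSymb (k : Type) [Field k] (d : ℕ) (u : Fin d → ℤ) :
    MvPolynomial (Fin d ⊕ Fin d) k :=
  ∑ i, u i • (X (Sum.inl i) * X (Sum.inr i))

open RingTheory.Sequence

/-- Every exponent on `σ ⊕ σ` is uniquely the sum of a diagonal exponent and an exponent with
no pair `inl i`, `inr i` both in its support. -/
def sigmaDisjointEquiv (σ : Type*) :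
    (Σ _ : {p : σ ⊕ σ →₀ ℕ // ∀ i, p (Sum.inl i) = 0 ∨ p (Sum.inr i) = 0}, σ →₀ ℕ) ≃
      (σ ⊕ σ →₀ ℕ) where
  toFun q := q.1.1 + q.2.sumElim q.2
  invFun e :=
    let t : σ →₀ ℕ := e.comapDomain Sum.inl Sum.inl_injective.injOn ⊓
      e.comapDomain Sum.inr Sum.inr_injective.injOn
    ⟨⟨e - t.sumElim t, fun i => by
      simp only [t, Finsupp.tsub_apply, Finsupp.sumElim_inl, Finsupp.sumElim_inr, Finsupp.inf_apply,
        Finsupp.comapDomain_apply]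
      omega⟩, t⟩
  left_inv := by
    rintro ⟨⟨p, hp⟩, t⟩
    have ht : (p + t.sumElim t).comapDomain Sum.inl Sum.inl_injective.injOn ⊓
        (p + t.sumElim t).comapDomain Sum.inr Sum.inr_injective.injOn = t := by
      ext i
      have := hp i
      simp
      omega
    simp [ht]
  right_inv e := by
    ext i
    rcases i with i | i <;> simp

/-- `R[x, ξ]` is flat over the subring generated by the products `x i * ξ i`. -/
theorem flat_aeval_X_inl_mul_X_inr (σ R : Type*) [CommRing R] :
    (aeval (fun i : σ => (X (Sum.inl i) * X (Sum.inr i) : MvPolynomial (σ ⊕ σ) R)) :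
      MvPolynomial σ R →ₐ[R] MvPolynomial (σ ⊕ σ) R).toRingHom.Flat := by
  set f : MvPolynomial σ R →ₐ[R] MvPolynomial (σ ⊕ σ) R :=
    aeval (fun i : σ => (X (Sum.inl i) * X (Sum.inr i) : MvPolynomial (σ ⊕ σ) R)) with hf
  have hmon (t : σ →₀ ℕ) : f (monomial t 1) = monomial (t.sumElim t) 1 := by
    rw [hf, aeval_monomial, map_one, one_mul, monomial_eq, Finsupp.prod_sumElim, map_one, one_mul,
      ← Finsupp.prod_mul]
    simp [mul_pow]
  algebraize [f.toRingHom]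
  have : IsScalarTower R (MvPolynomial σ R) (MvPolynomial (σ ⊕ σ) R) :=
    .of_algebraMap_eq fun r => (f.commutes r).symm
  let P := {p : σ ⊕ σ →₀ ℕ // ∀ i, p (Sum.inl i) = 0 ∨ p (Sum.inr i) = 0}
  let E : (P →₀ MvPolynomial σ R) ≃ₗ[R] MvPolynomial (σ ⊕ σ) R :=
    (Finsupp.basis fun _ : P => basisMonomials σ R).equiv (basisMonomials (σ ⊕ σ) R)
      (sigmaDisjointEquiv σ)
  let L : (P →₀ MvPolynomial σ R) →ₗ[MvPolynomial σ R] MvPolynomial (σ ⊕ σ) R :=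
    Finsupp.linearCombination _ fun p : P => monomial p.1 (1 : R)
  have hL : L.restrictScalars R = E.toLinearMap := by
    refine (Finsupp.basis fun _ : P => basisMonomials σ R).ext fun q => ?_
    have : algebraMap (MvPolynomial σ R) (MvPolynomial (σ ⊕ σ) R) (monomial q.2 1) =
      monomial (q.2.sumElim q.2) 1 := hmon q.2
    have hE : E (Finsupp.basis (fun _ : P => basisMonomials σ R) q) =
        basisMonomials (σ ⊕ σ) R (sigmaDisjointEquiv σ q) := Module.Basis.equiv_apply ..
    rw [LinearEquiv.coe_coe, hE]
    simp [L, Algebra.smul_def, this, monomial_mul, sigmaDisjointEquiv, add_comm]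
  have hbij : Function.Bijective L := by
    have : ⇑L = E := congrArg DFunLike.coe hL
    exact this ▸ E.bijective
  exact Module.Flat.of_linearEquiv (LinearEquiv.ofBijective L hbij).symm

/-- Distinct variables form a weakly regular sequence. -/
theorem isWeaklyRegular_map_X {σ R : Type*} [CommRing R] {l : List σ} (hl : l.Nodup) :
    IsWeaklyRegular (MvPolynomial σ R) (l.map X : List (MvPolynomial σ R)) := by
  refine ⟨fun i hi => (isSMulRegular_quotient_iff_mem_of_smul_mem _ _).mpr fun f hf => ?_⟩
  rw [List.length_map] at hi
  have hspan : (Ideal.ofList ((l.map (X (R := R))).take i) • ⊤ : Ideal (MvPolynomial σ R)) =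
      Ideal.span (X '' {a | a ∈ l.take i}) := by
    simp [Ideal.ofList, ← List.map_take, Set.image]
  rw [hspan, mem_ideal_span_X_image] at hf ⊢
  intro m hm
  obtain ⟨a, ha, h⟩ := hf (Finsupp.single l[i] 1 + m) (by
    simpa [mem_support_iff, add_comm] using hm)
  refine ⟨a, ha, ?_⟩
  have hne : l[i] ≠ a := by
    rintro rfl
    obtain ⟨j, hj, hji⟩ := List.mem_take_iff_getElem.mp ha
    have := (List.Nodup.getElem_inj_iff hl).mp hji
    omega
  simpa [Finsupp.single_eq_of_ne' hne] using h

/-- The ideal of the origin in affine `n`-space has height at least `n`. -/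
theorem natCard_le_height_ker_constantCoeff (σ k : Type*) [Finite σ] [Field k] :
    (Nat.card σ : ℕ∞) ≤ (RingHom.ker (constantCoeff : MvPolynomial σ k →+* k)).height := by
  cases nonempty_fintype σ
  set p := RingHom.ker (constantCoeff : MvPolynomial σ k →+* k)
  have : p.IsPrime := RingHom.ker_isPrime _
  have hreg := (isWeaklyRegular_map_X (R := k) (Finset.univ : Finset σ).nodup_toList)
    |>.isRegular_of_isLocalization_of_mem (Localization.AtPrime p) p (by simp [p])
  have hdim := ringKrullDim_add_length_eq_ringKrullDim_of_isRegular _ hreg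
  rw [IsLocalization.AtPrime.ringKrullDim_eq_height p (Localization.AtPrime p)] at hdim
  have : Nontrivial (Localization.AtPrime p ⧸ Ideal.ofList
      (((Finset.univ : Finset σ).toList.map X).map
        (algebraMap (MvPolynomial σ k) (Localization.AtPrime p)))) :=
    Ideal.Quotient.nontrivial_iff.mpr fun h => hreg.top_ne_smul (by rw [h]; simp)
  rw [← WithBot.coe_le_coe, ← hdim]
  simpa using le_add_of_nonneg_left (a := ((Nat.card σ : ℕ) : WithBot ℕ∞))
    ringKrullDim_nonneg_of_nontrivial

theorem supportDim_quotient_add_length_le {R M : Type*} [CommRing R] [AddCommGroup M] [Module R M]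
    [Module.Finite R M] {rs : List R} (hrs : IsWeaklyRegular M rs) :
    Module.supportDim R (M ⧸ (Ideal.ofList rs • ⊤ : Submodule R M)) + rs.length ≤
      Module.supportDim R M := by
  induction rs generalizing M with
  | nil =>
    rw [Ideal.ofList_nil, Submodule.bot_smul]
    simpa using (Module.supportDim_eq_of_equiv (Submodule.quotEquivOfEqBot ⊥ rfl)).le
  | cons x rs ih =>
    obtain ⟨hx, hrs⟩ := (isWeaklyRegular_cons_iff M _ _).mp hrs
    rw [Module.supportDim_eq_of_equiv (Submodule.quotOfListConsSMulTopEquivQuotSMulTopInner M x _),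
      List.length_cons, Nat.cast_succ, ← add_assoc]
    exact (add_le_add_left (ih hrs) 1).trans <|
      Module.supportDim_quotSMulTop_succ_le_of_notMem_minimalPrimes
        fun _ => hx.notMem_of_mem_minimalPrimes

theorem ringKrullDim_quotient_add_length_le {R : Type*} [CommRing R] {rs : List R}
    (hrs : IsWeaklyRegular R rs) :
    ringKrullDim (R ⧸ Ideal.ofList rs) + rs.length ≤ ringKrullDim R := by
  have := supportDim_quotient_add_length_le hrs
  rwa [smul_eq_mul, Ideal.mul_top, Module.supportDim_quotient_eq_ringKrullDim,
    Module.supportDim_self_eq_ringKrullDim] at this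

/-- The linear change of variables attached to a basis of `k ^ σ` is bijective. -/
theorem bijective_aeval_linearCombination_basis {σ ι k : Type*} [Fintype σ] [Field k]
    (b : Module.Basis ι k (σ → k)) :
    Function.Bijective (aeval (fun j => Fintype.linearCombination k X (b j)) :
      MvPolynomial ι k →ₐ[k] MvPolynomial σ k) := by
  classical
  set L : (σ → k) →ₗ[k] MvPolynomial σ k := Fintype.linearCombination k X
  set f : MvPolynomial ι k →ₐ[k] MvPolynomial σ k := aeval fun j => L (b j)
  let L' : (σ → k) →ₗ[k] MvPolynomial ι k := b.constr k X
  let g : MvPolynomial σ k →ₐ[k] MvPolynomial ι k := aeval fun i => L' (Pi.single i 1)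
  have hg : g.toLinearMap ∘ₗ L = L' := LinearMap.pi_ext' fun i => LinearMap.ext_ring <| by
    simp [g, L, Fintype.linearCombination_apply_single]
  have hf : f.toLinearMap ∘ₗ L' = L := b.ext fun j => by simp [f, L']
  have hgf : g.comp f = AlgHom.id k _ := algHom_ext fun j => by
    simpa [f, L'] using LinearMap.congr_fun hg (b j)
  have hfg : f.comp g = AlgHom.id k _ := algHom_ext fun i => by
    simpa [g, L, Fintype.linearCombination_apply_single] using
      LinearMap.congr_fun hf (Pi.single i 1)
  exact Function.bijective_iff_has_inverse.mpr
    ⟨g, DFunLike.congr_fun hgf, DFunLike.congr_fun hfg⟩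

theorem isWeaklyRegular_pSymb (k : Type) [Field k] [CharZero k] (d r : ℕ)
    (u : Fin r → Fin d → ℤ)
    (h : LinearIndependent ℚ fun j => fun i => ((u j i : ℤ) : ℚ)) :
    IsWeaklyRegular (MvPolynomial (Fin d ⊕ Fin d) k) (List.ofFn fun j => pSymb k d (u j)) := by
  have hk : LinearIndependent k fun j => fun i => ((u j i : ℤ) : k) := by
    have := (linearIndependent_algebraMap_comp_iff (R := ℚ) (S := k)).mpr h
    simpa [Function.comp_def] using this
  let I := hk.linearIndepOn_id.extend (Set.subset_univ _)
  let b : Module.Basis I k (Fin d → k) := .extend hk.linearIndepOn_id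
  let v (j : Fin r) : I := ⟨_, hk.linearIndepOn_id.subset_extend _ (Set.mem_range_self j)⟩
  have hv : Function.Injective v := fun _ _ hij => hk.injective (congrArg Subtype.val hij)
  let f := (aeval (R := k) (fun j => Fintype.linearCombination k
    (X : Fin d → MvPolynomial (Fin d) k) (b j)))
  let g := (aeval (fun i => X (Sum.inl i) * X (Sum.inr i)) :
      MvPolynomial (Fin d) k →ₐ[k] MvPolynomial (Fin d ⊕ Fin d) k)
  have hflat : (g.comp f).toRingHom.Flat :=
    (RingHom.Flat.of_bijective (bijective_aeval_linearCombination_basis b)).comp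
      (flat_aeval_X_inl_mul_X_inr (Fin d) k)
  algebraize [(g.comp f).toRingHom]
  have hreg := (isWeaklyRegular_map_X (R := k)
    (List.nodup_ofFn.mpr hv)).of_flat
      (S := MvPolynomial (Fin d ⊕ Fin d) k)
  have hX (j : Fin r) : algebraMap _ (MvPolynomial (Fin d ⊕ Fin d) k)
      (X (v j) : MvPolynomial I k) =
        pSymb k d (u j) := by
    change g (f (X (v j))) = _
    have hb : b (v j) = fun i => ((u j i : ℤ) : k) :=
      Module.Basis.extend_apply_self hk.linearIndepOn_id _
    simp [f, g, hb, pSymb, Fintype.linearCombination_apply, Algebra.smul_def]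
  simpa [List.map_ofFn, Function.comp_def, hX] using hreg

/-- If `r ≤ d` and `u_1, …, u_r ∈ ℤ^d` are linearly independent over `ℚ`, then
`p_{u_1}, …, p_{u_r}` is a regular sequence in `R` and the Krull dimension of
`R/(p_{u_1},…,p_{u_r})` is `2d − r`. -/
theorem pSymb_regular_and_dim (k : Type) [Field k] [CharZero k] (d r : ℕ) (hr : r ≤ d)
    (u : Fin r → Fin d → ℤ)
    (h : LinearIndependent ℚ fun j => fun i => ((u j i : ℤ) : ℚ)) :
    RingTheory.Sequence.IsRegular (MvPolynomial (Fin d ⊕ Fin d) k)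
        (List.ofFn fun j => pSymb k d (u j)) ∧
    ringKrullDim ((MvPolynomial (Fin d ⊕ Fin d) k) ⧸
        Ideal.span (Set.range fun j => pSymb k d (u j))) = (2 * d - r : ℕ) := by
  have hreg := isWeaklyRegular_pSymb k d r u h
  have hspan : Ideal.ofList (List.ofFn fun j => pSymb k d (u j)) =
      Ideal.span (Set.range fun j => pSymb k d (u j)) := by
    simp [Ideal.ofList, List.mem_ofFn, Set.range]
  set s := Set.range fun j => pSymb k d (u j)
  set p := RingHom.ker (constantCoeff : MvPolynomial (Fin d ⊕ Fin d) k →+* k)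
  have hp : p.IsPrime := RingHom.ker_isPrime _
  have hsp : s ⊆ p := by
    rintro _ ⟨j, rfl⟩
    simp [p, RingHom.mem_ker, pSymb]
  have hupper := ringKrullDim_quotient_add_length_le hreg
  rw [hspan, List.length_ofFn, MvPolynomial.ringKrullDim_of_isNoetherianRing,
    ringKrullDim_eq_zero_of_field, zero_add] at hupper
  have hs : s.encard ≤ r := by
    simpa [Set.encard_univ] using Set.encard_image_le (fun j => pSymb k d (u j)) Set.univ
  have hlower : ((2 * d : ℕ) : WithBot ℕ∞) ≤
      ringKrullDim (MvPolynomial (Fin d ⊕ Fin d) k ⧸ Ideal.span s) + r := by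
    have h₁ := natCard_le_height_ker_constantCoeff (Fin d ⊕ Fin d) k
    have h₂ := Ideal.height_le_ringKrullDim_quotient_add_encard s hsp
    rw [← WithBot.coe_le_coe] at h₁
    replace h₁ := h₁.trans h₂
    simp only [Nat.card_sum, Nat.card_fin] at h₁
    calc ((2 * d : ℕ) : WithBot ℕ∞) = ((d + d : ℕ) : ℕ∞) := by rw [two_mul]; rfl
      _ ≤ _ := h₁
      _ ≤ _ := by gcongr; exact_mod_cast hs
  refine ⟨⟨hreg, ?_⟩, ?_⟩
  · rw [hspan, smul_eq_mul, Ideal.mul_top]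
    exact fun h => hp.ne_top (top_le_iff.mp (h.le.trans (Ideal.span_le.mpr hsp)))
  · simp only [Nat.card_sum, Nat.card_fin, ← two_mul] at hupper
    have heq := hupper.antisymm hlower
    rw [← ENat.WithBot.add_natCast_cancel (c := r), heq, ← Nat.cast_add,
      Nat.sub_add_cancel (by omega)]
end
end

section
/- Let r ≥ 1 and let u_1,…,u_r ∈ ℤ^d be such that for every index i ∈ {1,…,d}, the vectors in ℤ^{d−1} obtained from u_1,…,u_r by deleting the i-th coordinate are still linearly independent over ℚ. Then the quotient ring R/(p_{u_1},…,p_{u_r}) is a normal integral domain (an integrally closed domain); in particular the ideal (p_{u_1},…,p_{u_r}) of R is prime. (Part of Proposition 5.7: the variety Z = V(𝔭) ⊆ 𝔸^d × 𝔸^d is normal and integral; the deletion hypothesis encodes the toric fact that for each i the map ⊕_{j≠i} ℤe_j → Cl(X) is surjective.) -/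
open MvPolynomial

noncomputable section

/-- `C`, with structure map `ι` and elements `x i`, `y i`, is the `B`-algebra generated by the
`x i` and `y i` subject only to the relations `x i * y i = f i`. -/
structure IsHyperbolaExtension {σ B C : Type} [CommRing B] [CommRing C] (ι : B →+* C)
    (f : σ → B) (x y : σ → C) : Prop where
  mul_eq : ∀ i, x i * y i = ι (f i)
  eq_top : ∀ S : Subring C, (∀ b, ι b ∈ S) → (∀ i, x i ∈ S) → (∀ i, y i ∈ S) → S = ⊤
  exists_lift : ∀ {D : Type} [CommRing D] (α : B →+* D) (x' y' : σ → D),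
    (∀ i, x' i * y' i = α (f i)) →
      ∃ φ : C →+* D, (∀ b, φ (ι b) = α b) ∧ (∀ i, φ (x i) = x' i) ∧ ∀ i, φ (y i) = y' i

namespace IsHyperbolaExtension

theorem symm {σ B C : Type} [CommRing B] [CommRing C] {ι : B →+* C} {f : σ → B}
    {x y : σ → C} (h : IsHyperbolaExtension ι f x y) : IsHyperbolaExtension ι f y x where
  mul_eq i := by rw [mul_comm, h.mul_eq]
  eq_top S hb hx hy := h.eq_top S hb hy hx
  exists_lift α x' y' hxy := by
    obtain ⟨φ, h1, h2, h3⟩ := h.exists_lift α y' x' fun i => by rw [mul_comm, hxy]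
    exact ⟨φ, h1, h3, h2⟩

theorem exists_extension {σ B : Type} [CommRing B] (f : σ → B) :
    ∃ (C : Type) (_ : CommRing C) (ι : B →+* C) (x y : σ → C),
      IsHyperbolaExtension ι f x y := by
  let I : Ideal (MvPolynomial (σ ⊕ σ) B) :=
    Ideal.span (Set.range fun i => X (Sum.inl i) * X (Sum.inr i) - MvPolynomial.C (f i))
  refine ⟨MvPolynomial (σ ⊕ σ) B ⧸ I, inferInstance, (Ideal.Quotient.mk I).comp MvPolynomial.C,
    fun i => Ideal.Quotient.mk I (X (Sum.inl i)), fun i => Ideal.Quotient.mk I (X (Sum.inr i)),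
    ⟨fun i => ?_, fun S hb hx hy => ?_, fun {D} _ α x' y' hxy => ?_⟩⟩
  · rw [← map_mul, RingHom.comp_apply, Ideal.Quotient.eq]
    exact Ideal.subset_span ⟨i, rfl⟩
  · rw [eq_top_iff]
    rintro z -
    obtain ⟨p, rfl⟩ := Ideal.Quotient.mk_surjective z
    induction p using MvPolynomial.induction_on with
    | C b => exact hb b
    | add p q hp hq => rw [map_add]; exact S.add_mem hp hq
    | mul_X p i hp =>
      rw [map_mul]
      refine S.mul_mem hp ?_
      cases i with
      | inl i => exact hx i
      | inr i => exact hy i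
  · refine ⟨Ideal.Quotient.lift I (eval₂Hom α (Sum.elim x' y')) fun a ha => ?_,
      fun b => by simp, fun i => by simp, fun i => by simp⟩
    rw [← RingHom.mem_ker]
    refine (Ideal.span_le.mpr ?_ : I ≤ _) ha
    rintro _ ⟨i, rfl⟩
    simp [RingHom.mem_ker, hxy i]

section Single

variable {B A : Type} [CommRing B] [CommRing A] {ι : B →+* A} {f : B} {x y : A}

theorem exists_eq_add (h : IsHyperbolaExtension ι (fun _ : Unit => f) (fun _ => x) fun _ => y)
    (a : A) : ∃ g q : Polynomial B, a = x * g.eval₂ ι x + q.eval₂ ι y := by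
  have hxy : x * y = ι f := h.mul_eq ()
  have hx : ∀ a, (∃ g q : Polynomial B, a = x * g.eval₂ ι x + q.eval₂ ι y) →
      ∃ g q : Polynomial B, x * a = x * g.eval₂ ι x + q.eval₂ ι y := by
    rintro _ ⟨g, q, rfl⟩
    refine ⟨Polynomial.X * g + Polynomial.C (q.coeff 0), Polynomial.C f * q.divX, ?_⟩
    conv_lhs => rw [← q.divX_mul_X_add]
    simp only [Polynomial.eval₂_add, Polynomial.eval₂_mul, Polynomial.eval₂_X,
      Polynomial.eval₂_C, ← hxy]
    ring
  have hy : ∀ a, (∃ g q : Polynomial B, a = x * g.eval₂ ι x + q.eval₂ ι y) →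
      ∃ g q : Polynomial B, y * a = x * g.eval₂ ι x + q.eval₂ ι y := by
    rintro _ ⟨g, q, rfl⟩
    refine ⟨Polynomial.C f * g.divX, Polynomial.X * q + Polynomial.C (f * g.coeff 0), ?_⟩
    conv_lhs => rw [← g.divX_mul_X_add]
    simp only [Polynomial.eval₂_add, Polynomial.eval₂_mul, Polynomial.eval₂_X,
      Polynomial.eval₂_C, map_mul, ← hxy]
    ring
  have hb : ∀ b a, (∃ g q : Polynomial B, a = x * g.eval₂ ι x + q.eval₂ ι y) →
      ∃ g q : Polynomial B, ι b * a = x * g.eval₂ ι x + q.eval₂ ι y := by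
    rintro b _ ⟨g, q, rfl⟩
    refine ⟨Polynomial.C b * g, Polynomial.C b * q, ?_⟩
    simp only [Polynomial.eval₂_mul, Polynomial.eval₂_C]
    ring
  have hadd : ∀ a a', (∃ g q : Polynomial B, a = x * g.eval₂ ι x + q.eval₂ ι y) →
      (∃ g q : Polynomial B, a' = x * g.eval₂ ι x + q.eval₂ ι y) →
      ∃ g q : Polynomial B, a + a' = x * g.eval₂ ι x + q.eval₂ ι y := by
    rintro _ _ ⟨g, q, rfl⟩ ⟨g', q', rfl⟩
    refine ⟨g + g', q + q', ?_⟩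
    simp only [Polynomial.eval₂_add]
    ring
  have hone : ∃ g q : Polynomial B, (1 : A) = x * g.eval₂ ι x + q.eval₂ ι y :=
    ⟨0, 1, by simp⟩
  let S : Subring A :=
    { carrier := {s | ∀ a, (∃ g q : Polynomial B, a = x * g.eval₂ ι x + q.eval₂ ι y) →
        ∃ g q : Polynomial B, s * a = x * g.eval₂ ι x + q.eval₂ ι y}
      mul_mem' := fun {s t} hs ht a ha => by rw [mul_assoc]; exact hs _ (ht _ ha)
      one_mem' := fun a ha => by rwa [one_mul]
      add_mem' := fun {s t} hs ht a ha => by rw [add_mul]; exact hadd _ _ (hs _ ha) (ht _ ha)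
      zero_mem' := fun a _ => ⟨0, 0, by simp⟩
      neg_mem' := fun {s} hs a ha => by
        have := hb (-1) _ (hs a ha)
        rwa [map_neg, map_one, ← mul_assoc, neg_one_mul] at this }
  have hS : S = ⊤ := h.eq_top S hb (fun _ => hx) fun _ => hy
  have ha : a ∈ S := hS ▸ Subring.mem_top a
  simpa only [mul_one] using ha 1 hone

theorem dvd_of_dvd_mul (h : IsHyperbolaExtension ι (fun _ : Unit => f) (fun _ => x) fun _ => y)
    {a : A} (hya : x ∣ y * a) : x ∣ a := by
  have hxy : x * y = ι f := h.mul_eq ()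
  obtain ⟨φ, hφ, hφx, hφy⟩ := h.exists_lift
    (Polynomial.C.comp (Ideal.Quotient.mk (Ideal.span {f}))) (fun _ => 0)
    (fun _ => Polynomial.X) (fun _ => by simp)
  obtain ⟨g, q, rfl⟩ := h.exists_eq_add a
  have hq : φ (q.eval₂ ι y) = q.map (Ideal.Quotient.mk (Ideal.span {f})) := by
    have hcomp : φ.comp ι = Polynomial.C.comp (Ideal.Quotient.mk (Ideal.span {f})) :=
      RingHom.ext hφ
    rw [Polynomial.hom_eval₂, hφy (), hcomp, Polynomial.map]
  obtain ⟨b, hb⟩ := hya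
  have h0 := congrArg φ hb
  simp only [map_mul, map_add, hφx (), hφy (), hq, zero_mul, zero_add] at h0
  have hq0 : q.map (Ideal.Quotient.mk (Ideal.span {f})) = 0 := by
    ext n
    simpa using congrArg (fun p => p.coeff (n + 1)) h0
  have hdvd : Polynomial.C f ∣ q := by
    rw [Polynomial.C_dvd_iff_dvd_coeff]
    intro n
    rw [← Ideal.mem_span_singleton, ← Ideal.Quotient.eq_zero_iff_mem, ← Polynomial.coeff_map,
      hq0, Polynomial.coeff_zero]
  obtain ⟨q', rfl⟩ := hdvd
  refine dvd_add (dvd_mul_right _ _) ?_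
  rw [Polynomial.eval₂_mul, Polynomial.eval₂_C, ← hxy, mul_assoc]
  exact dvd_mul_right _ _

theorem dvd_of_dvd_pow_mul
    (h : IsHyperbolaExtension ι (fun _ : Unit => f) (fun _ => x) fun _ => y)
    {a : A} (m : ℕ) (hya : x ∣ y ^ m * a) : x ∣ a := by
  induction m with
  | zero => simpa using hya
  | succ m ih => exact ih (h.dvd_of_dvd_mul (by rwa [← mul_assoc, ← pow_succ']))

/-- The embedding of `B[x, y]/(xy - f)` into the Laurent polynomials in `x`. -/
theorem exists_toLaurent [IsDomain B] (hf : f ≠ 0)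
    (h : IsHyperbolaExtension ι (fun _ : Unit => f) (fun _ => x) fun _ => y) :
    ∃ φ : A →+* LaurentPolynomial B, Function.Injective φ ∧
      (∀ b, φ (ι b) = LaurentPolynomial.C b) ∧ φ x = LaurentPolynomial.T 1 := by
  obtain ⟨φ, hφ, hφx, hφy⟩ := h.exists_lift LaurentPolynomial.C
    (fun _ => LaurentPolynomial.T 1) (fun _ => LaurentPolynomial.C f * LaurentPolynomial.T (-1))
    (fun _ => by rw [mul_left_comm, ← LaurentPolynomial.T_add]; simp)
  refine ⟨φ, (injective_iff_map_eq_zero φ).mpr fun a ha => ?_, hφ, hφx ()⟩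
  obtain ⟨g, q, rfl⟩ := h.exists_eq_add a
  have hg : φ (x * g.eval₂ ι x) = Polynomial.toLaurent (Polynomial.X * g) := by
    have key : (φ.comp (Polynomial.eval₂RingHom ι x)) = Polynomial.toLaurent := by
      ext b
      · simp [hφ]
      · simp [hφx ()]
    rw [map_mul, map_mul, hφx (), Polynomial.toLaurent_X, ← key]
    rfl
  have hq : φ (q.eval₂ ι y) = LaurentPolynomial.invert
      (Polynomial.toLaurent (q.comp (Polynomial.C f * Polynomial.X))) := by
    have key : (φ.comp (Polynomial.eval₂RingHom ι y)) =
        ((LaurentPolynomial.invert (R := B)).toRingEquiv.toRingHom.comp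
          Polynomial.toLaurent).comp
            (Polynomial.compRingHom (Polynomial.C f * Polynomial.X)) := by
      ext b
      · simp [hφ]
      · simp [hφy ()]
    exact congrArg (fun ψ => ψ q) key
  rw [map_add, hg, hq] at ha
  set H := q.comp (Polynomial.C f * Polynomial.X) with hH
  have hsum : Polynomial.X ^ (H.natDegree + 1) * g + H.reverse = 0 := by
    rw [← Polynomial.toLaurent_eq_zero, map_add, LaurentPolynomial.toLaurent_reverse,
      pow_succ, mul_assoc, map_mul, Polynomial.toLaurent_X_pow, LaurentPolynomial.T_mul,
      ← add_mul, ha, zero_mul]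
  have hH0 : H.reverse = 0 := by
    ext n
    rcases lt_or_ge H.natDegree n with hn | hn
    · exact Polynomial.coeff_eq_zero_of_natDegree_lt (H.reverse_natDegree_le.trans_lt hn)
    · have := congrArg (fun p => p.coeff n) hsum
      simpa [Polynomial.coeff_X_pow_mul', Nat.not_le.mpr (Nat.lt_succ_of_le hn)] using this
  have hq0 : q = 0 := by
    ext n
    have hn : H.coeff n = 0 := by rw [Polynomial.reverse_eq_zero.mp hH0, Polynomial.coeff_zero]
    rw [hH, Polynomial.comp_C_mul_X_coeff] at hn
    simpa [hf] using hn
  have hg0 : g = 0 := by simpa [hH0] using hsum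
  simp [hg0, hq0]

end Single

end IsHyperbolaExtension

theorem isDomain_laurentPolynomial (B : Type) [CommRing B] [IsDomain B] :
    IsDomain (LaurentPolynomial B) :=
  IsLocalization.isDomain_of_le_nonZeroDivisors (R := Polynomial B)
    (M := Submonoid.powers Polynomial.X) _ (powers_le_nonZeroDivisors_of_noZeroDivisors Polynomial.X_ne_zero)

theorem isIntegrallyClosed_laurentPolynomial (B : Type) [CommRing B] [IsDomain B]
    [IsIntegrallyClosed B] : IsIntegrallyClosed (LaurentPolynomial B) :=
  isIntegrallyClosed_of_isLocalization (R := Polynomial B) _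
    (Submonoid.powers Polynomial.X) (powers_le_nonZeroDivisors_of_noZeroDivisors Polynomial.X_ne_zero)

theorem map_dvd_map_of_isIntegral {A L : Type} [CommRing A] [IsDomain A] [CommRing L] [IsDomain L]
    [IsIntegrallyClosed L] {φ : A →+* L} (hφ : Function.Injective φ) {a b : A} (hb : b ≠ 0)
    (hab : IsIntegral A (algebraMap A (FractionRing A) a / algebraMap A (FractionRing A) b)) :
    φ b ∣ φ a := by
  have hinj : Function.Injective ((algebraMap L (FractionRing L)).comp φ) :=
    (IsFractionRing.injective L (FractionRing L)).comp hφ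
  let ψ : FractionRing A →+* FractionRing L := IsFractionRing.lift hinj
  have hψ : ∀ c, ψ (algebraMap A (FractionRing A) c) = algebraMap L (FractionRing L) (φ c) :=
    fun c => IsFractionRing.lift_algebraMap hinj c
  have hint := hab.map_of_comp_eq φ ψ (RingHom.ext fun c => (hψ c).symm)
  obtain ⟨p, hp⟩ := IsIntegrallyClosed.isIntegral_iff.mp hint
  refine ⟨p, IsFractionRing.injective L (FractionRing L) ?_⟩
  have hb' : algebraMap L (FractionRing L) (φ b) ≠ 0 := by
    intro h0
    exact hb (hinj (by simpa using h0))
  rw [map_mul, hp, map_div₀, hψ, hψ, mul_div_cancel₀ _ hb']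

namespace IsHyperbolaExtension

variable {B A : Type} [CommRing B] [CommRing A] {ι : B →+* A} {f : B} {x y : A}

theorem injective_and_isDomain [IsDomain B] (hf : f ≠ 0)
    (h : IsHyperbolaExtension ι (fun _ : Unit => f) (fun _ => x) fun _ => y) :
    Function.Injective ι ∧ IsDomain A ∧ x ≠ 0 := by
  obtain ⟨φ, hφ, hC, hx⟩ := h.exists_toLaurent hf
  have hinj : Function.Injective ι := by
    refine (injective_iff_map_eq_zero ι).mpr fun b hb => ?_
    have h0 := hC b
    rw [hb, map_zero, ← Polynomial.toLaurent_C, eq_comm, Polynomial.toLaurent_eq_zero,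
      Polynomial.C_eq_zero] at h0
    exact h0
  have := isDomain_laurentPolynomial B
  refine ⟨hinj, hφ.isDomain φ, ?_⟩
  rintro rfl
  exact (LaurentPolynomial.isUnit_T (R := B) 1).ne_zero (by rw [← hx, map_zero])

theorem exists_pow_mul_eq [IsDomain B] [IsIntegrallyClosed B] [IsDomain A] (hf : f ≠ 0)
    (h : IsHyperbolaExtension ι (fun _ : Unit => f) (fun _ => x) fun _ => y)
    {a b : A} (hb : b ≠ 0)
    (hab : IsIntegral A (algebraMap A (FractionRing A) a / algebraMap A (FractionRing A) b)) :
    ∃ (n : ℕ) (c : A), x ^ n * a = b * c := by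
  obtain ⟨φ, hφ, hC, hx⟩ := h.exists_toLaurent hf
  have := isDomain_laurentPolynomial B
  have := isIntegrallyClosed_laurentPolynomial B
  obtain ⟨p, hp⟩ := map_dvd_map_of_isIntegral hφ hb hab
  obtain ⟨n, p', hp'⟩ := p.exists_T_pow
  refine ⟨n, p'.eval₂ ι x, hφ ?_⟩
  have key : (φ.comp (Polynomial.eval₂RingHom ι x)) = Polynomial.toLaurent := by
    ext b
    · simp [hC]
    · simp [hx]
  have hp'' : φ (p'.eval₂ ι x) = p * LaurentPolynomial.T n := by
    rw [← hp', ← key]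
    rfl
  rw [map_mul, map_mul, hp'', map_pow, hx, hp, LaurentPolynomial.T_pow, mul_one]
  ring

theorem isIntegrallyClosed [IsDomain B] [IsIntegrallyClosed B] (hf : f ≠ 0)
    (h : IsHyperbolaExtension ι (fun _ : Unit => f) (fun _ => x) fun _ => y) :
    IsIntegrallyClosed A := by
  obtain ⟨-, hA, hx0⟩ := h.injective_and_isDomain hf
  refine (isIntegrallyClosed_iff (FractionRing A)).mpr fun {z} hz => ?_
  obtain ⟨a, b, hb, rfl⟩ := IsFractionRing.div_surjective (A := A) z
  have hb0 : b ≠ 0 := nonZeroDivisors.ne_zero hb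
  obtain ⟨n, c, hc⟩ := h.exists_pow_mul_eq hf hb0 hz
  obtain ⟨m, c', hc'⟩ := h.symm.exists_pow_mul_eq hf hb0 hz
  have hdvd : ∀ (n : ℕ) (c : A), x ^ n * a = b * c → ∃ e, a = b * e := by
    intro n
    induction n with
    | zero => exact fun c hc => ⟨c, by simpa using hc⟩
    | succ n ih =>
      intro c hc
      have hcc : y ^ m * c = x ^ (n + 1) * c' := by
        refine mul_left_cancel₀ hb0 ?_
        linear_combination x ^ (n + 1) * hc' - y ^ m * hc
      obtain ⟨e, rfl⟩ := h.dvd_of_dvd_pow_mul m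
        (hcc ▸ (dvd_pow_self x n.succ_ne_zero).mul_right c')
      refine ih e (mul_left_cancel₀ hx0 ?_)
      linear_combination hc
  obtain ⟨e, rfl⟩ := hdvd n c hc
  refine ⟨e, ?_⟩
  rw [map_mul, mul_div_cancel_left₀]
  simpa using hb0

theorem exists_normal_extension (n : ℕ) : ∀ {T : Type} [CommRing T] [IsDomain T]
    [IsIntegrallyClosed T] (f : Fin n → T), (∀ i, f i ≠ 0) →
    ∃ (C : Type) (_ : CommRing C) (ι : T →+* C) (x y : Fin n → C),
      IsHyperbolaExtension ι f x y ∧ IsDomain C ∧ IsIntegrallyClosed C := by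
  induction n with
  | zero =>
    intro T _ _ _ f _
    refine ⟨T, inferInstance, RingHom.id T, Fin.elim0, Fin.elim0,
      ⟨fun i => i.elim0, fun S hb _ _ => ?_, fun α _ _ _ => ?_⟩, inferInstance, inferInstance⟩
    · exact eq_top_iff.mpr fun t _ => hb t
    · exact ⟨α, fun _ => rfl, fun i => i.elim0, fun i => i.elim0⟩
  | succ n ih =>
    intro T _ _ _ f hf
    obtain ⟨B, _, β, x₀, y₀, hB⟩ := exists_extension fun _ : Unit => f 0
    have hB' : IsHyperbolaExtension β (fun _ : Unit => f 0) (fun _ => x₀ ()) fun _ => y₀ () := hB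
    obtain ⟨hβ, _, -⟩ := hB'.injective_and_isDomain (hf 0)
    have := hB'.isIntegrallyClosed (hf 0)
    obtain ⟨C, _, γ, x, y, hC, hdom, hcl⟩ := ih (fun i => β (f i.succ)) fun i =>
      (map_ne_zero_iff β hβ).mpr (hf i.succ)
    refine ⟨C, inferInstance, γ.comp β, Fin.cons (γ (x₀ ())) x, Fin.cons (γ (y₀ ())) y,
      ⟨fun i => ?_, fun S hb hx hy => ?_, fun {D} _ α x' y' hxy => ?_⟩, hdom, hcl⟩
    · refine Fin.cases ?_ (fun i => ?_) i
      · simp only [Fin.cons_zero, RingHom.comp_apply, ← map_mul, hB.mul_eq]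
      · simp only [Fin.cons_succ, RingHom.comp_apply, hC.mul_eq]
    · refine hC.eq_top S (fun b => ?_) (fun i => hx i.succ) fun i => hy i.succ
      have htop := hB.eq_top (S.comap γ) hb (fun _ => hx 0) fun _ => hy 0
      exact (htop ▸ Subring.mem_top b : b ∈ S.comap γ)
    · obtain ⟨φ, hφ, hφx, hφy⟩ := hB.exists_lift α (fun _ => x' 0) (fun _ => y' 0)
        fun _ => hxy 0
      obtain ⟨ψ, hψ, hψx, hψy⟩ := hC.exists_lift φ (fun i => x' i.succ) (fun i => y' i.succ)
        fun i => by rw [hφ, hxy]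
      refine ⟨ψ, fun b => ?_, Fin.cases ?_ fun i => ?_, Fin.cases ?_ fun i => ?_⟩
      · rw [RingHom.comp_apply, hψ, hφ]
      · rw [Fin.cons_zero, hψ, hφx]
      · rw [Fin.cons_succ, hψx]
      · rw [Fin.cons_zero, hψ, hφy]
      · rw [Fin.cons_succ, hψy]

end IsHyperbolaExtension

/-- A standard basis vector does not lie in the span of vectors which stay linearly independent
after deleting the corresponding coordinate. -/
theorem single_notMem_span_of_linearIndependent {k : Type} [Field k] [CharZero k] {d r : ℕ}
    (u : Fin r → Fin d → ℤ) (i : Fin d)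
    (h : LinearIndependent ℚ
      fun j => fun i' : {i' : Fin d // i' ≠ i} => ((u j (i' : Fin d) : ℤ) : ℚ)) :
    (Pi.single i 1 : Fin d → k) ∉
      Submodule.span k (Set.range fun j => fun i' => (u j i' : k)) := by
  intro hmem
  have hk := (linearIndependent_algebraMap_comp_iff (S := k)).mpr h
  obtain ⟨c, hc⟩ := (Submodule.mem_span_range_iff_exists_fun k).mp hmem
  have hc0 : ∀ j, c j = 0 := by
    refine Fintype.linearIndependent_iff.mp hk c ?_
    ext i'
    have := congrFun hc i'
    simpa [Finset.sum_apply, Pi.single_eq_of_ne i'.2] using this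
  have := congrFun hc i
  simp [hc0] at this

theorem exists_surjective_ker_eq_span (k : Type) [Field k] [CharZero k] (d r : ℕ)
    (u : Fin r → Fin d → ℤ)
    (h : ∀ i : Fin d, LinearIndependent ℚ
      fun j => fun i' : {i' : Fin d // i' ≠ i} => ((u j (i' : Fin d) : ℤ) : ℚ)) :
    ∃ (C : Type) (_ : CommRing C) (φ : MvPolynomial (Fin d ⊕ Fin d) k →+* C),
      IsDomain C ∧ IsIntegrallyClosed C ∧ Function.Surjective φ ∧
        RingHom.ker φ = Ideal.span (Set.range fun j => pSymb k d (u j)) := by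
  set I := Ideal.span (Set.range fun j => pSymb k d (u j))
  let v : Fin r → Fin d → k := fun j i => (u j i : k)
  let V : Submodule k (Fin d → k) := Submodule.span k (Set.range v)
  let b := Module.finBasis k ((Fin d → k) ⧸ V)
  let T := MvPolynomial (Fin (Module.finrank k ((Fin d → k) ⧸ V))) k
  let form : ((Fin d → k) ⧸ V) →ₗ[k] T := b.constr k X
  have hform : Function.Injective form :=
    b.injective_constr_of_linearIndependent (linearIndependent_X _ _)
  let f : Fin d → T := fun i => form (V.mkQ (Pi.single i 1))
  have hf : ∀ i, f i ≠ 0 := by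
    intro i h0
    have := (map_eq_zero_iff form hform).mp h0
    rw [Submodule.mkQ_apply, Submodule.Quotient.mk_eq_zero] at this
    exact single_notMem_span_of_linearIndependent u i (h i) this
  let P : (Fin d → k) →ₗ[k] MvPolynomial (Fin d ⊕ Fin d) k :=
    Fintype.linearCombination k fun i => X (Sum.inl i) * X (Sum.inr i)
  have hP : ∀ j, P (v j) = pSymb k d (u j) := by
    intro j
    simp only [P, v, pSymb, Fintype.linearCombination_apply, Int.cast_smul_eq_zsmul]
  obtain ⟨C, _, ι, x, y, hC, hdom, hcl⟩ :=
    IsHyperbolaExtension.exists_normal_extension d f hf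
  let φ : MvPolynomial (Fin d ⊕ Fin d) k →+* C :=
    eval₂Hom (ι.comp MvPolynomial.C) (Sum.elim x y)
  have hφP : ∀ w, φ (P w) = ι (form (V.mkQ w)) := by
    intro w
    conv_rhs => rw [pi_eq_sum_univ' w]
    simp only [P, Fintype.linearCombination_apply, map_sum, map_smul]
    refine Finset.sum_congr rfl fun i _ => ?_
    have hsmul : w i • form (V.mkQ (Pi.single i 1)) = MvPolynomial.C (w i) * f i :=
      smul_eq_C_mul _ _
    rw [hsmul, smul_eq_C_mul, map_mul ι]
    simp [φ, hC.mul_eq]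
  refine ⟨C, inferInstance, φ, hdom, hcl, ?_, le_antisymm ?_ ?_⟩
  · rw [← RingHom.range_eq_top]
    refine hC.eq_top _ (fun t => ?_) (fun i => ⟨X (Sum.inl i), by simp [φ]⟩)
      fun i => ⟨X (Sum.inr i), by simp [φ]⟩
    induction t using MvPolynomial.induction_on with
    | C c => exact ⟨MvPolynomial.C c, by simp [φ]⟩
    | add p q hp hq => rw [map_add]; exact add_mem hp hq
    | mul_X p j hp =>
      rw [map_mul]
      refine mul_mem hp ?_
      obtain ⟨w, hw⟩ := V.mkQ_surjective (b j)
      refine ⟨P w, ?_⟩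
      rw [hφP, hw, b.constr_basis]
  · let L : (Fin d → k) →ₗ[k] MvPolynomial (Fin d ⊕ Fin d) k ⧸ I :=
      (Ideal.Quotient.mkₐ k I).toLinearMap ∘ₗ P
    have hL : V ≤ LinearMap.ker L := by
      refine Submodule.span_le.mpr ?_
      rintro _ ⟨j, rfl⟩
      refine Ideal.Quotient.eq_zero_iff_mem.mpr ?_
      rw [hP]
      exact Ideal.subset_span ⟨j, rfl⟩
    let Λ := V.liftQ L hL
    let α : T →ₐ[k] MvPolynomial (Fin d ⊕ Fin d) k ⧸ I := aeval fun j => Λ (b j)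
    have hα : ∀ w, α (form w) = Λ w := by
      have : α.toLinearMap ∘ₗ form = Λ := b.ext fun j => by
        rw [LinearMap.comp_apply, b.constr_basis]
        exact aeval_X _ j
      exact fun w => congrArg (fun g => g w) this
    obtain ⟨ψ, hψ, hψx, hψy⟩ := hC.exists_lift α.toRingHom
      (fun i => Ideal.Quotient.mk I (X (Sum.inl i)))
      (fun i => Ideal.Quotient.mk I (X (Sum.inr i))) fun i => by
        refine Eq.symm ((hα _).trans ?_)
        simp [Λ, L, P]
    have hcomp : ψ.comp φ = Ideal.Quotient.mk I := by
      refine MvPolynomial.ringHom_ext (fun c => ?_) fun i => ?_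
      · simp only [φ, RingHom.comp_apply, coe_eval₂Hom, eval₂_C, hψ]
        exact α.commutes c
      · cases i with
        | inl i => simp [φ, hψx]
        | inr i => simp [φ, hψy]
    intro p hp
    rw [← Ideal.Quotient.eq_zero_iff_mem, ← hcomp, RingHom.comp_apply,
      RingHom.mem_ker.mp hp, map_zero]
  · refine Ideal.span_le.mpr ?_
    rintro _ ⟨j, rfl⟩
    have hv : V.mkQ (v j) = 0 :=
      (Submodule.Quotient.mk_eq_zero V).mpr (Submodule.subset_span ⟨j, rfl⟩)
    simp only [SetLike.mem_coe, RingHom.mem_ker, ← hP, hφP, hv, map_zero]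

/-- If for every coordinate `i` the vectors obtained from `u_1,…,u_r` by deleting the
`i`-th coordinate remain linearly independent over `ℚ`, then `R/(p_{u_1},…,p_{u_r})` is a
normal (integrally closed) integral domain; in particular `(p_{u_1},…,p_{u_r})` is prime. -/
theorem quotient_pSymb_normal_domain (k : Type) [Field k] [CharZero k] [IsAlgClosed k]
    (d r : ℕ) (hr : 1 ≤ r) (u : Fin r → Fin d → ℤ)
    (h : ∀ i : Fin d, LinearIndependent ℚ
      fun j => fun i' : {i' : Fin d // i' ≠ i} => ((u j (i' : Fin d) : ℤ) : ℚ)) :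
    (Ideal.span (Set.range fun j => pSymb k d (u j))).IsPrime ∧
    IsDomain ((MvPolynomial (Fin d ⊕ Fin d) k) ⧸
        Ideal.span (Set.range fun j => pSymb k d (u j))) ∧
    IsIntegrallyClosed ((MvPolynomial (Fin d ⊕ Fin d) k) ⧸
        Ideal.span (Set.range fun j => pSymb k d (u j))) := by
  obtain ⟨C, _, φ, hdom, hcl, hsurj, hker⟩ := exists_surjective_ker_eq_span k d r u h
  have hprime : (Ideal.span (Set.range fun j => pSymb k d (u j))).IsPrime :=
    hker ▸ RingHom.ker_isPrime φ
  exact ⟨hprime, (Ideal.Quotient.isDomain_iff_prime _).mpr hprime,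
    IsIntegrallyClosed.of_equiv
      ((Ideal.quotEquivOfEq hker.symm).trans (RingHom.quotientKerEquivOfSurjective hsurj)).symm⟩
end
end
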